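/- (Decomposition of flows / Kunita-type formula.) Let E₀, E₁, E be Banach spaces, 1 ≤ p < 2, and q ≥ 1 with 1/p + 1/q > 1. Let U ∈ V^p([0,T],E₀), X ∈ V^p([0,T],E₁), and let f : E → L(E₀,E) and g : E → L(E₁,E) be continuously differentiable with γ-Hölder derivative for some γ with p < 1 + γ. Let V ∈ V^p([0,T],E) satisfy V_t = V_0 + ∫_0^t f(V_s) dU_s, and let Y : [0,T] × E → E be a flow of the equation dY = g(Y)dX, i.e. for each x ∈ E, Y_·(x) ∈ V^p([0,T],E) and Y_t(x) = x + ∫_0^t g(Y_s(x)) dX_s; assume each Y_t : E → E is a twice continuously differentiable diffeomorphism, that (t,x) ↦ Y_t(x), D_xY_t(x), D²_xY_t(x) are continuous, and that x ↦ (s ↦ g(Y_s(x))) is continuous from E to the (1/q)-Hölder paths C_H^{1/q}([0,T],L(E₁,E)). Then the path Z_t = Y_t(V_t) satisfies, for all t ∈ [0,T], Z_t = V_0 + ∫_0^t g(Z_s) dX_s + ∫_0^t ((Y_s)_* f)(Z_s) dU_s, where ((Y_s)_* f)(z) = D_xY_s(Y_s^{-1}(z)) ∘ f(Y_s^{-1}(z))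 ∈ L(E₀,E), all integrals being Young integrals which exist. -/

import Mathlib

open Set Filter Topology

noncomputable section

/-- The `p`-variation of a path `X : ℝ → E` on the interval `[a,b]`,
`‖X‖_{p,[a,b]} = (sup_D Σ_i ‖X_{t_{i+1}} − X_{t_i}‖^p)^(1/p)`, the supremum being taken
over all finite partitions `a = t₀ ≤ t₁ ≤ … ≤ t_k = b`. -/
def pVar {E : Type*} [NormedAddCommGroup E] (p : ℝ) (X : ℝ → E) (a b : ℝ) : ENNReal :=
  ⨆ (k : ℕ) (t : Fin (k + 1) → ℝ)
    (_ : Monotone t ∧ t 0 = a ∧ t (Fin.last k) = b),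
    (∑ i : Fin k, (‖X (t i.succ) - X (t i.castSucc)‖₊ : ENNReal) ^ p) ^ (1 / p)

/-- `X ∈ V^p([a,b],E)`: `X` is continuous on `[a,b]` and has finite `p`-variation there. -/
def MemVp {E : Type*} [NormedAddCommGroup E] (p : ℝ) (X : ℝ → E) (a b : ℝ) : Prop :=
  ContinuousOn X (Set.Icc a b) ∧ pVar p X a b < ⊤

/-- A partition `a = t₀ ≤ t₁ ≤ … ≤ t_k = b` of `[a,b]`. -/
structure YoungPartition (a b : ℝ) where
  k : ℕ
  t : Fin (k + 1) → ℝ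
  mono : Monotone t
  first : t 0 = a
  last : t (Fin.last k) = b

/-- The mesh of a partition. -/
def YoungPartition.mesh {a b : ℝ} (D : YoungPartition a b) : ℝ :=
  ⨆ i : Fin D.k, (D.t i.succ - D.t i.castSucc)

/-- The Riemann sum `Σ_i Z_{t_i}(X_{t_{i+1}} − X_{t_i})` along a partition. -/
def riemannSum {E F : Type*} [NormedAddCommGroup E] [NormedSpace ℝ E]
    [NormedAddCommGroup F] [NormedSpace ℝ F]
    (Z : ℝ → E →L[ℝ] F) (X : ℝ → E) {a b : ℝ} (D : YoungPartition a b) : F :=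
  ∑ i : Fin D.k, Z (D.t i.castSucc) (X (D.t i.succ) - X (D.t i.castSucc))

/-- `IsYoungIntegral Z X a b I` : the Riemann sums of `Z` against `X` over partitions of `[a,b]`
converge to `I` as the mesh tends to `0`; i.e. the Young integral `∫_a^b Z dX` exists and
equals `I`. -/
def IsYoungIntegral {E F : Type*} [NormedAddCommGroup E] [NormedSpace ℝ E]
    [NormedAddCommGroup F] [NormedSpace ℝ F]
    (Z : ℝ → E →L[ℝ] F) (X : ℝ → E) (a b : ℝ) (I : F) : Prop :=
  Filter.Tendsto (fun D : YoungPartition a b => riemannSum Z X D)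
    (Filter.comap YoungPartition.mesh (nhds 0)) (nhds I)

/-- View a vector `v : E` as the continuous linear map `ℝ →L[ℝ] E`, `c ↦ c • v`; used to
integrate vector-valued integrands against scalar integrators. -/
def toCLM {E : Type*} [NormedAddCommGroup E] [NormedSpace ℝ E] (v : E) : ℝ →L[ℝ] E :=
  (1 : ℝ →L[ℝ] ℝ).smulRight v

/-- The `α`-Hölder seminorm `‖X‖_{α;H} = sup_{s ≠ t ∈ [a,b]} ‖X_t − X_s‖ / |t−s|^α` of a path. -/
def holderSemiPath {E : Type*} [NormedAddCommGroup E] (α : ℝ) (X : ℝ → E) (a b : ℝ) : ENNReal :=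
  ⨆ (s : Set.Icc a b) (t : Set.Icc a b) (_ : (s : ℝ) ≠ (t : ℝ)),
    (‖X (t : ℝ) - X (s : ℝ)‖₊ : ENNReal) / edist (s : ℝ) (t : ℝ) ^ α

/-- The `α`-Hölder norm (sup norm plus Hölder seminorm) of a path on `[a,b]`. -/
def holderNormPath {E : Type*} [NormedAddCommGroup E] (α : ℝ) (X : ℝ → E) (a b : ℝ) : ENNReal :=
  (⨆ t : Set.Icc a b, (‖X (t : ℝ)‖₊ : ENNReal)) + holderSemiPath α X a b

/-- The `γ`-Hölder constant `‖f‖_{γ,H} = sup_{x ≠ y} ‖f x − f y‖ / ‖x − y‖^γ` of a map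
between normed spaces. -/
def holderConst {E F : Type*} [NormedAddCommGroup E] [NormedAddCommGroup F]
    (γ : ℝ) (f : E → F) : ENNReal :=
  ⨆ (x : E) (y : E) (_ : x ≠ y), (‖f x - f y‖₊ : ENNReal) / (‖x - y‖₊ : ENNReal) ^ γ

section Germs

variable {F : Type*} [NormedAddCommGroup F]

/-- The sum `Σ_i A(t_i, t_{i+1})` of a two-parameter germ along a partition. -/
def germSum (A : ℝ → ℝ → F) {a b : ℝ} (D : YoungPartition a b) : F :=
  ∑ i : Fin D.k, A (D.t i.castSucc) (D.t i.succ)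

namespace YoungPartition

variable {a b : ℝ}

/-- The points of a partition as a sequence, constant after the last point. -/
def seq (D : YoungPartition a b) (i : ℕ) : ℝ :=
  D.t ⟨min i D.k, by omega⟩

theorem seq_monotone (D : YoungPartition a b) : Monotone D.seq := fun i j hij =>
  D.mono (by simp only [Fin.mk_le_mk]; omega)

theorem seq_zero (D : YoungPartition a b) : D.seq 0 = a := by
  exact Eq.trans (congrArg D.t (by ext; simp)) D.first

theorem seq_last (D : YoungPartition a b) : D.seq D.k = b := by
  exact Eq.trans (congrArg D.t (by ext; simp)) D.last

theorem seq_castSucc (D : YoungPartition a b) (i : Fin D.k) : D.seq i = D.t i.castSucc := by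
  unfold seq; congr 1; ext; simp

theorem seq_succ (D : YoungPartition a b) (i : Fin D.k) : D.seq (i + 1) = D.t i.succ := by
  unfold seq; congr 1; ext; simp

theorem germSum_eq_sum_range (A : ℝ → ℝ → F) (D : YoungPartition a b) :
    germSum A D = ∑ i ∈ Finset.range D.k, A (D.seq i) (D.seq (i + 1)) := by
  rw [← Fin.sum_univ_eq_sum_range (fun i => A (D.seq i) (D.seq (i + 1)))]
  simp only [germSum, seq_castSucc, seq_succ]

theorem seq_step_le_mesh (D : YoungPartition a b) {i : ℕ} (hi : i < D.k) :
    D.seq (i + 1) - D.seq i ≤ D.mesh := by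
  rw [D.seq_castSucc ⟨i, hi⟩, D.seq_succ ⟨i, hi⟩]
  exact le_ciSup (f := fun i : Fin D.k => D.t i.succ - D.t i.castSucc)
    (Set.finite_range _).bddAbove ⟨i, hi⟩

theorem mesh_nonneg (D : YoungPartition a b) : 0 ≤ D.mesh :=
  Real.iSup_nonneg fun i => sub_nonneg.2 (D.mono i.castSucc_lt_succ.le)

/-- The partition whose points are the first terms of a monotone sequence. -/
def ofSeq (τ : ℕ → ℝ) (hτ : Monotone τ) (k : ℕ) (h0 : τ 0 = a) (hk : τ k = b) :
    YoungPartition a b where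
  k := k
  t i := τ i
  mono _ _ hij := hτ hij
  first := h0
  last := hk

theorem germSum_ofSeq (A : ℝ → ℝ → F) (τ : ℕ → ℝ) (hτ : Monotone τ) (k : ℕ)
    (h0 : τ 0 = a) (hk : τ k = b) :
    germSum A (ofSeq τ hτ k h0 hk) = ∑ i ∈ Finset.range k, A (τ i) (τ (i + 1)) :=
  Fin.sum_univ_eq_sum_range (fun i => A (τ i) (τ (i + 1))) k

theorem mesh_ofSeq_le {τ : ℕ → ℝ} {hτ : Monotone τ} {k : ℕ} {h0 : τ 0 = a} {hk : τ k = b}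
    {δ : ℝ} (hδ : 0 ≤ δ) (h : ∀ i, τ (i + 1) - τ i ≤ δ) : (ofSeq τ hτ k h0 hk).mesh ≤ δ :=
  Real.iSup_le (fun i => h i) hδ

theorem hasBasis_comap_mesh :
    (comap (mesh (a := a) (b := b)) (𝓝 0)).HasBasis (fun δ : ℝ => 0 < δ)
      fun δ => {D | D.mesh < δ} := by
  convert Metric.nhds_basis_ball.comap (mesh (a := a) (b := b)) using 2 with δ
  ext D
  simp [abs_of_nonneg D.mesh_nonneg]

theorem tendsto_comap_mesh_iff {S : YoungPartition a b → F} {I : F} :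
    Tendsto S (comap mesh (𝓝 0)) (𝓝 I) ↔
      ∀ ε > 0, ∃ δ > 0, ∀ D : YoungPartition a b, D.mesh < δ → ‖S D - I‖ < ε := by
  rw [hasBasis_comap_mesh.tendsto_iff Metric.nhds_basis_ball]
  simp [dist_eq_norm]

end YoungPartition

/-- The constant in the maximal inequality for germ sums. -/
def sewingConst (θ : ℝ) : ℝ := 2 / (1 - 2 ^ (1 - θ))

theorem two_rpow_one_sub_lt_one {θ : ℝ} (hθ : 1 < θ) : (2 : ℝ) ^ (1 - θ) < 1 :=
  Real.rpow_lt_one_of_one_lt_of_neg one_lt_two (by linarith)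

theorem sewingConst_nonneg {θ : ℝ} (hθ : 1 < θ) : 0 ≤ sewingConst θ :=
  div_nonneg zero_le_two (by linarith [two_rpow_one_sub_lt_one hθ])

theorem sewingConst_recursion {θ : ℝ} (hθ : 1 < θ) :
    2 * (sewingConst θ * (2 : ℝ)⁻¹ ^ θ) + 2 = sewingConst θ := by
  have h := two_rpow_one_sub_lt_one hθ
  have h2 : (2 : ℝ) * (2 : ℝ)⁻¹ ^ θ = 2 ^ (1 - θ) := by
    rw [Real.rpow_sub two_pos, Real.rpow_one, Real.inv_rpow zero_le_two, div_eq_mul_inv]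
  have h3 : (1 - (2 : ℝ) ^ (1 - θ)) ≠ 0 := by linarith
  rw [mul_left_comm, h2, sewingConst]
  field_simp
  ring

/-- A monotone real sequence on `[m, n]` has a step on both sides of which it increases by at most
half of its total increment. -/
theorem exists_halving_step {x : ℕ → ℝ} {m n : ℕ} (hmn : m < n) (hx : x m ≤ x n) :
    ∃ j, m ≤ j ∧ j < n ∧ x j - x m ≤ (x n - x m) / 2 ∧ x n - x (j + 1) ≤ (x n - x m) / 2 := by
  classical
  have hex : ∃ k, m < k ∧ (k = n ∨ (x n - x m) / 2 < x k - x m) := ⟨n, hmn, .inl rfl⟩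
  obtain ⟨h1, h2⟩ := Nat.find_spec hex
  have hle : Nat.find hex ≤ n := Nat.find_min' hex ⟨hmn, .inl rfl⟩
  have hmin := fun j (hj : j < Nat.find hex) => Nat.find_min hex hj
  generalize Nat.find hex = k at h1 h2 hle hmin
  obtain ⟨j, rfl⟩ : ∃ j, k = j + 1 := ⟨k - 1, by omega⟩
  refine ⟨j, by omega, by omega, ?_, ?_⟩
  · rcases (show m ≤ j by omega).eq_or_lt with rfl | hmj
    · linarith
    · by_contra! hlt
      exact hmin j (by omega) ⟨hmj, .inr hlt⟩
  · rcases h2 with h2 | h2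
    · rw [h2]; linarith
    · linarith

variable {a b θ : ℝ} {φ : ℝ → ℝ} {A : ℝ → ℝ → F}

/-- Young's maximal inequality: if the defect of additivity of a germ is bounded by a power
`θ > 1` of a control, then so is the difference between its sum along any partition and its value
on the whole interval. -/
theorem norm_sum_germ_sub_le (hφ : MonotoneOn φ (Set.Icc a b)) (hθ : 1 < θ)
    (hA0 : ∀ s, A s s = 0) {M : ℝ} (hM0 : 0 ≤ M)
    (hM : ∀ r s u, a ≤ r → r ≤ s → s ≤ u → u ≤ b →
      ‖A r u - A r s - A s u‖ ≤ M * (φ u - φ r) ^ θ)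
    {t : ℕ → ℝ} (ht : Monotone t) {m n : ℕ} (hmn : m ≤ n) (ha : a ≤ t m) (hb : t n ≤ b) :
    ‖∑ i ∈ Finset.Ico m n, A (t i) (t (i + 1)) - A (t m) (t n)‖ ≤
      sewingConst θ * M * (φ (t n) - φ (t m)) ^ θ := by
  have hC := sewingConst_nonneg hθ
  induction hk : n - m using Nat.strong_induction_on generalizing m n with
  | _ k ih =>
  have hmem : ∀ i, m ≤ i → i ≤ n → t i ∈ Set.Icc a b := fun i h1 h2 =>
    ⟨ha.trans (ht h1), (ht h2).trans hb⟩
  have hmono : ∀ i j, m ≤ i → i ≤ j → j ≤ n → φ (t i) ≤ φ (t j) := fun i j h1 h2 h3 =>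
    hφ (hmem i h1 (h2.trans h3)) (hmem j (h1.trans h2) h3) (ht h2)
  rcases hmn.eq_or_lt with rfl | hlt
  · simp [hA0, Real.zero_rpow (by linarith : θ ≠ 0)]
  obtain ⟨j, hmj, hjn, hl, hr⟩ := exists_halving_step (x := fun i => φ (t i)) hlt
    (hmono m n le_rfl hmn le_rfl)
  have half : ∀ y, 0 ≤ y → y ≤ (φ (t n) - φ (t m)) / 2 →
      y ^ θ ≤ (2 : ℝ)⁻¹ ^ θ * (φ (t n) - φ (t m)) ^ θ := by
    intro y hy0 hy
    rw [← Real.mul_rpow (by norm_num) (by linarith [hmono m n le_rfl hmn le_rfl])]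
    exact Real.rpow_le_rpow hy0 (by linarith) (by linarith)
  have i1 := ih (j - m) (by omega) hmj ha (hmem j hmj hjn.le).2 rfl
  have i2 := ih (n - (j + 1)) (by omega) hjn (hmem (j + 1) (by omega) hjn).1 hb rfl
  have i3 := hM (t m) (t (j + 1)) (t n) ha (ht (by omega)) (ht hjn) hb
  have i4 := hM (t m) (t j) (t (j + 1)) ha (ht hmj) (ht (by omega)) (hmem (j + 1) (by omega) hjn).2
  have i5 : (φ (t (j + 1)) - φ (t m)) ^ θ ≤ (φ (t n) - φ (t m)) ^ θ :=
    Real.rpow_le_rpow (by linarith [hmono m (j + 1) le_rfl (by omega) hjn])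
      (by linarith [hmono (j + 1) n (by omega) hjn le_rfl]) (by linarith)
  have h1 := half _ (by linarith [hmono m j le_rfl hmj hjn.le]) hl
  have h2 := half _ (by linarith [hmono (j + 1) n (by omega) hjn le_rfl]) hr
  have hsplit : ∑ i ∈ Finset.Ico m n, A (t i) (t (i + 1)) - A (t m) (t n) =
      (∑ i ∈ Finset.Ico m j, A (t i) (t (i + 1)) - A (t m) (t j)) +
      (∑ i ∈ Finset.Ico (j + 1) n, A (t i) (t (i + 1)) - A (t (j + 1)) (t n)) -
      (A (t m) (t n) - A (t m) (t (j + 1)) - A (t (j + 1)) (t n)) -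
      (A (t m) (t (j + 1)) - A (t m) (t j) - A (t j) (t (j + 1))) := by
    rw [← Finset.sum_Ico_consecutive _ (show m ≤ j + 1 by omega) hjn,
      Finset.sum_Ico_succ_top hmj]
    abel
  rw [hsplit]
  have hCM : 0 ≤ sewingConst θ * M := mul_nonneg hC hM0
  calc _ ≤ _ + _ + _ + _ := (norm_sub_le _ _).trans (add_le_add ((norm_sub_le _ _).trans
          (add_le_add (norm_add_le _ _) le_rfl)) le_rfl)
    _ ≤ sewingConst θ * M * ((2 : ℝ)⁻¹ ^ θ * (φ (t n) - φ (t m)) ^ θ) +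
        sewingConst θ * M * ((2 : ℝ)⁻¹ ^ θ * (φ (t n) - φ (t m)) ^ θ) +
        M * (φ (t n) - φ (t m)) ^ θ + M * (φ (t n) - φ (t m)) ^ θ := by
      gcongr
      · exact i1.trans (mul_le_mul_of_nonneg_left h1 hCM)
      · exact i2.trans (mul_le_mul_of_nonneg_left h2 hCM)
      · exact i4.trans (mul_le_mul_of_nonneg_left i5 hM0)
    _ = (2 * (sewingConst θ * (2 : ℝ)⁻¹ ^ θ) + 2) * M * (φ (t n) - φ (t m)) ^ θ := by ring
    _ = _ := by rw [sewingConst_recursion hθ]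

theorem norm_sum_le_of_norm_le_rpow (hφ : MonotoneOn φ (Set.Icc a b)) (hφ1 : φ b - φ a ≤ 1)
    (hθ : 1 < θ) {M : ℝ} (hM : 0 ≤ M) {d : ℕ → ℝ} (hd : Monotone d) {k : ℕ} (h0 : d 0 = a)
    (hk : d k = b) {e : ℕ → F}
    (he : ∀ i < k, ‖e i‖ ≤ M * (φ (d (i + 1)) - φ (d i)) ^ θ) :
    ‖∑ i ∈ Finset.range k, e i‖ ≤ M := by
  have hmem : ∀ i ≤ k, d i ∈ Set.Icc a b := fun i hi => ⟨h0 ▸ hd i.zero_le, hk ▸ hd hi⟩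
  have hle : ∀ i j, i ≤ j → j ≤ k → φ (d i) ≤ φ (d j) := fun i j hij hj =>
    hφ (hmem i (hij.trans hj)) (hmem j hj) (hd hij)
  calc ‖∑ i ∈ Finset.range k, e i‖ ≤ ∑ i ∈ Finset.range k, M * (φ (d (i + 1)) - φ (d i)) := by
        refine norm_sum_le_of_le _ fun i hi => ?_
        have hi : i < k := Finset.mem_range.1 hi
        refine (he i hi).trans (mul_le_mul_of_nonneg_left ?_ hM)
        have h1 := hle 0 i i.zero_le hi.le
        have h2 := hle i (i + 1) i.le_succ hi
        have h3 := hle (i + 1) k hi le_rfl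
        rw [h0] at h1
        rw [hk] at h3
        exact Real.rpow_le_self_of_le_one (by linarith) (by linarith) hθ.le
    _ = M * (φ b - φ a) := by
        rw [← Finset.mul_sum, Finset.sum_range_sub (fun i => φ (d i)), h0, hk]
    _ ≤ M := mul_le_of_le_one_right hM hφ1

/-- The defect of additivity of the germ `A` on `[a, b]` is locally negligible with respect to the
power `θ` of the control with primitive `φ`. -/
def IsAlmostAdditive (φ : ℝ → ℝ) (θ a b : ℝ) (A : ℝ → ℝ → F) : Prop :=
  ∀ ε > 0, ∃ δ > 0, ∀ r s u, a ≤ r → r ≤ s → s ≤ u → u ≤ b → u - r ≤ δ →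
    ‖A r u - A r s - A s u‖ ≤ ε * (φ u - φ r) ^ θ

/-- Cutting `[x, y]` down to `[z, w]` and cutting `[z, w]` down to `[x, y]` have the same effect on
germs vanishing on the diagonal. -/
theorem germ_clamp_comm (hA0 : ∀ s, A s s = 0) {x y z w : ℝ} (hxy : x ≤ y) (hzw : z ≤ w) :
    A (max z (min x w)) (max z (min y w)) = A (max x (min z y)) (max x (min w y)) := by
  rcases lt_or_ge w x with h | h
  · rw [min_eq_right h.le, min_eq_right (h.le.trans hxy),
      max_eq_left ((min_le_left z y).trans (hzw.trans h.le)),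
      max_eq_left ((min_le_left w y).trans h.le), hA0, hA0]
  rcases lt_or_ge y z with h' | h'
  · rw [min_eq_right h'.le, min_eq_right (h'.le.trans hzw),
      max_eq_left ((min_le_left x w).trans (hxy.trans h'.le)),
      max_eq_left ((min_le_left y w).trans h'.le), hA0, hA0]
  rw [min_eq_left h, min_eq_left h', max_comm, min_comm, max_eq_right (le_min hzw h'),
    max_eq_right (le_min h hxy)]

theorem norm_sum_germ_sub_sum_clamp_le (hφ : MonotoneOn φ (Set.Icc a b)) (hφ1 : φ b - φ a ≤ 1)
    (hθ : 1 < θ) (hA0 : ∀ s, A s s = 0) {M δ : ℝ} (hM0 : 0 ≤ M)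
    (hM : ∀ r s u, a ≤ r → r ≤ s → s ≤ u → u ≤ b → u - r ≤ δ →
      ‖A r u - A r s - A s u‖ ≤ M * (φ u - φ r) ^ θ)
    {d τ : ℕ → ℝ} (hd : Monotone d) (hτ : Monotone τ) {k l : ℕ} (hd0 : d 0 = a) (hdk : d k = b)
    (hτ0 : τ 0 = a) (hτl : τ l = b) (hδ : ∀ i < k, d (i + 1) - d i ≤ δ) :
    ‖∑ i ∈ Finset.range k, A (d i) (d (i + 1)) -
      ∑ i ∈ Finset.range k, ∑ j ∈ Finset.range l,
        A (max (d i) (min (τ j) (d (i + 1)))) (max (d i) (min (τ (j + 1)) (d (i + 1))))‖ ≤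
      sewingConst θ * M := by
  rw [← Finset.sum_sub_distrib]
  refine norm_sum_le_of_norm_le_rpow hφ hφ1 hθ (mul_nonneg (sewingConst_nonneg hθ) hM0) hd hd0 hdk
    fun i hi => ?_
  have hai : a ≤ d i := hd0 ▸ hd i.zero_le
  have hib : d (i + 1) ≤ b := hdk ▸ hd hi
  have hii : d i ≤ d (i + 1) := hd i.le_succ
  have h := norm_sum_germ_sub_le (A := A) (hφ.mono (Set.Icc_subset_Icc hai hib)) hθ hA0 hM0
    (fun r s u h1 h2 h3 h4 => hM r s u (hai.trans h1) h2 h3 (h4.trans hib)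
      (by linarith [hδ i hi]))
    (t := fun j => max (d i) (min (τ j) (d (i + 1))))
    (fun j j' hj => max_le_max le_rfl (min_le_min (hτ hj) le_rfl)) (Nat.zero_le l)
    (le_max_left _ _) (max_le hii (min_le_right _ _))
  have e0 : max (d i) (min (τ 0) (d (i + 1))) = d i := by
    rw [hτ0]; exact max_eq_left ((min_le_left _ _).trans hai)
  have e1 : max (d i) (min (τ l) (d (i + 1))) = d (i + 1) := by
    rw [hτl, min_eq_right hib, max_eq_right hii]
  simp only [e0, e1] at h
  rw [norm_sub_rev, Finset.range_eq_Ico]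
  exact h

/-- The sums of an almost additive germ converge as the mesh tends to zero. -/
theorem IsAlmostAdditive.exists_tendsto_germSum [CompleteSpace F]
    (hA : IsAlmostAdditive φ θ a b A) (hφ : MonotoneOn φ (Set.Icc a b)) (hφ1 : φ b - φ a ≤ 1)
    (hθ : 1 < θ) (hA0 : ∀ s, A s s = 0) :
    ∃ I, Tendsto (fun D : YoungPartition a b => germSum A D)
      (comap YoungPartition.mesh (𝓝 0)) (𝓝 I) := by
  rcases (comap (YoungPartition.mesh (a := a) (b := b)) (𝓝 0)).eq_or_neBot with hbot | hne
  · exact ⟨0, by rw [hbot]; exact tendsto_bot⟩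
  refine cauchy_map_iff_exists_tendsto.1 (Metric.cauchy_iff.2 ⟨inferInstance, fun η hη => ?_⟩)
  have hC := sewingConst_nonneg hθ
  obtain ⟨δ, hδ, hM⟩ := hA (η / (2 * sewingConst θ + 1)) (by positivity)
  refine ⟨_, image_mem_map (YoungPartition.hasBasis_comap_mesh.mem_of_mem hδ), ?_⟩
  rintro _ ⟨D, hD, rfl⟩ _ ⟨D', hD', rfl⟩
  have hM0 : 0 ≤ η / (2 * sewingConst θ + 1) := by positivity
  have h1 := norm_sum_germ_sub_sum_clamp_le hφ hφ1 hθ hA0 hM0 hM D.seq_monotone D'.seq_monotone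
    D.seq_zero D.seq_last D'.seq_zero D'.seq_last
    fun i hi => (D.seq_step_le_mesh hi).trans (le_of_lt hD)
  have h2 := norm_sum_germ_sub_sum_clamp_le hφ hφ1 hθ hA0 hM0 hM D'.seq_monotone D.seq_monotone
    D'.seq_zero D'.seq_last D.seq_zero D.seq_last
    fun i hi => (D'.seq_step_le_mesh hi).trans (le_of_lt hD')
  rw [Finset.sum_comm, norm_sub_rev] at h2
  simp_rw [fun i j => germ_clamp_comm hA0 (D.seq_monotone (Nat.le_succ i))
    (D'.seq_monotone (Nat.le_succ j))] at h2
  dsimp only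
  rw [dist_eq_norm, D.germSum_eq_sum_range, D'.germSum_eq_sum_range]
  calc _ ≤ _ := norm_sub_le_norm_sub_add_norm_sub _ _ _
    _ ≤ _ := add_le_add h1 h2
    _ = η * ((2 * sewingConst θ) / (2 * sewingConst θ + 1)) := by ring
    _ < η := mul_lt_of_lt_one_right hη ((div_lt_one (by positivity)).2 (by linarith))

/-- If a germ approximates the increments of a path `J` up to a negligible error, then its sums
converge to the increment of `J`. -/
theorem tendsto_germSum_of_increment {J : ℝ → F} (hφ : MonotoneOn φ (Set.Icc a b))
    (hφ1 : φ b - φ a ≤ 1) (hθ : 1 < θ)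
    (hJ : ∀ ε > 0, ∃ δ > 0, ∀ r u, a ≤ r → r ≤ u → u ≤ b → u - r ≤ δ →
      ‖A r u - (J u - J r)‖ ≤ ε * (φ u - φ r) ^ θ) :
    Tendsto (fun D : YoungPartition a b => germSum A D)
      (comap YoungPartition.mesh (𝓝 0)) (𝓝 (J b - J a)) := by
  refine YoungPartition.tendsto_comap_mesh_iff.2 fun ε hε => ?_
  obtain ⟨δ, hδ, h⟩ := hJ (ε / 2) (by positivity)
  refine ⟨δ, hδ, fun D hD => lt_of_le_of_lt ?_ (half_lt_self hε)⟩
  have hsum : J b - J a = ∑ i ∈ Finset.range D.k, (J (D.seq (i + 1)) - J (D.seq i)) := by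
    rw [Finset.sum_range_sub (fun i => J (D.seq i)), D.seq_last, D.seq_zero]
  rw [hsum, D.germSum_eq_sum_range, ← Finset.sum_sub_distrib]
  refine norm_sum_le_of_norm_le_rpow hφ hφ1 hθ (by positivity) D.seq_monotone D.seq_zero D.seq_last
    fun i hi => ?_
  exact h _ _ (D.seq_zero.ge.trans (D.seq_monotone i.zero_le)) (D.seq_monotone i.le_succ)
    ((D.seq_monotone hi).trans D.seq_last.le) ((D.seq_step_le_mesh hi).trans hD.le)

/-- The Young estimate: the increments of the limit of the sums of a germ are approximated by the
germ. -/
theorem norm_increment_sub_germ_le {J : ℝ → F} (hφ : MonotoneOn φ (Set.Icc a b))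
    (hθ : 1 < θ) (hA0 : ∀ s, A s s = 0)
    (hJ : ∀ t ∈ Set.Icc a b, Tendsto (fun D : YoungPartition a t => germSum A D)
      (comap YoungPartition.mesh (𝓝 0)) (𝓝 (J t)))
    {M δ : ℝ} (hM0 : 0 ≤ M)
    (hM : ∀ r s u, a ≤ r → r ≤ s → s ≤ u → u ≤ b → u - r ≤ δ →
      ‖A r u - A r s - A s u‖ ≤ M * (φ u - φ r) ^ θ)
    {r u : ℝ} (har : a ≤ r) (hru : r ≤ u) (hub : u ≤ b) (hδ : u - r ≤ δ) :
    ‖J u - J r - A r u‖ ≤ sewingConst θ * M * (φ u - φ r) ^ θ := by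
  refine le_of_forall_pos_le_add fun η hη => ?_
  obtain ⟨δ₁, hδ₁, h1⟩ := YoungPartition.tendsto_comap_mesh_iff.1
    (hJ r ⟨har, hru.trans hub⟩) (η / 2) (by positivity)
  obtain ⟨δ₂, hδ₂, h2⟩ := YoungPartition.tendsto_comap_mesh_iff.1
    (hJ u ⟨har.trans hru, hub⟩) (η / 2) (by positivity)
  obtain ⟨N, hN⟩ := exists_nat_gt ((u - a) / min δ₁ δ₂)
  have hδm : 0 < min δ₁ δ₂ := lt_min hδ₁ hδ₂
  have hN0 : (0 : ℝ) < N := lt_of_le_of_lt (div_nonneg (by linarith) hδm.le) hN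
  have hstep : (u - a) / N < min δ₁ δ₂ := by
    rw [div_lt_iff₀ hδm] at hN
    rw [div_lt_iff₀ hN0]; linarith
  -- uniform grid with `N` steps on `[a, r]` followed by a uniform grid with `N` steps on `[r, u]`
  let τ : ℕ → ℝ := fun i => a + (r - a) / N * (min i N : ℕ) + (u - r) / N * (i - N : ℕ)
  have hra0 : 0 ≤ (r - a) / N := div_nonneg (by linarith) hN0.le
  have hur0 : 0 ≤ (u - r) / N := div_nonneg (by linarith) hN0.le
  have hτ : Monotone τ := by
    intro i j hij
    have e1 : ((min i N : ℕ) : ℝ) ≤ (min j N : ℕ) := by exact_mod_cast min_le_min hij le_rfl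
    have e2 : ((i - N : ℕ) : ℝ) ≤ (j - N : ℕ) := by exact_mod_cast Nat.sub_le_sub_right hij N
    dsimp only [τ]
    gcongr
  have hτ0 : τ 0 = a := by simp [τ]
  have hτN : τ N = r := by simp [τ]; field_simp; ring
  have hτ2 : τ (N + N) = u := by simp [τ]; field_simp; ring
  have hτs : ∀ i, τ (i + 1) - τ i ≤ (u - a) / N := by
    intro i
    have e3 : (u - a) / N = (r - a) / N + (u - r) / N := by ring
    rcases lt_or_ge i N with hi | hi
    · have e1 : min (i + 1) N = i + 1 := by omega
      have e2 : i + 1 - N = 0 := by omega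
      have e4 : i - N = 0 := by omega
      simp only [τ, e1, e2, e4, min_eq_left hi.le]
      push_cast
      linarith
    · have e1 : min (i + 1) N = N := by omega
      have e2 : i + 1 - N = (i - N) + 1 := by omega
      simp only [τ, e1, e2, min_eq_right hi, Nat.cast_add, Nat.cast_one]
      linarith
  have hua0 : 0 ≤ (u - a) / N := div_nonneg (by linarith) hN0.le
  have k1 := h1 (.ofSeq τ hτ N hτ0 hτN) (lt_of_le_of_lt (YoungPartition.mesh_ofSeq_le hua0 hτs)
    (hstep.trans_le (min_le_left _ _)))
  have k2 := h2 (.ofSeq τ hτ (N + N) hτ0 hτ2)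
    (lt_of_le_of_lt (YoungPartition.mesh_ofSeq_le hua0 hτs) (hstep.trans_le (min_le_right _ _)))
  rw [YoungPartition.germSum_ofSeq] at k1 k2
  have k3 := norm_sum_germ_sub_le (hφ.mono (Set.Icc_subset_Icc har hub)) hθ hA0 hM0
    (fun x y z h1 h2 h3 h4 => hM x y z (har.trans h1) h2 h3 (h4.trans hub) (by linarith))
    hτ (Nat.le_add_right N N) hτN.ge hτ2.le
  rw [hτN, hτ2] at k3
  rw [Finset.range_eq_Ico] at k1 k2
  rw [← Finset.sum_Ico_consecutive _ (Nat.zero_le N) (Nat.le_add_right N N)] at k2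
  generalize ∑ i ∈ Finset.Ico 0 N, A (τ i) (τ (i + 1)) = S₁ at k1 k2
  generalize ∑ i ∈ Finset.Ico N (N + N), A (τ i) (τ (i + 1)) = S₂ at k2 k3
  have hdec : J u - J r - A r u = (S₂ - A r u) + (S₁ - J r) - (S₁ + S₂ - J u) := by abel
  rw [hdec]
  calc _ ≤ _ + _ + _ := (norm_sub_le _ _).trans (add_le_add (norm_add_le _ _) le_rfl)
    _ ≤ _ + η / 2 + η / 2 := add_le_add (add_le_add k3 k1.le) k2.le
    _ = _ := by ring

end Germs

section Control

variable {G : Type*} [NormedAddCommGroup G]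

theorem sum_rpow_le_pVar {p : ℝ} (hp : 0 < p) {P : ℝ → G} {a b : ℝ} (hP : pVar p P a b < ⊤)
    {u : ℕ → ℝ} (hu : Monotone u) {n : ℕ} (h0 : u 0 = a) (hn : u n = b) :
    ∑ i ∈ Finset.range n, ‖P (u (i + 1)) - P (u i)‖ ^ p ≤ (pVar p P a b).toReal ^ p := by
  have h : (∑ i : Fin n, (‖P (u (i + 1)) - P (u i)‖₊ : ENNReal) ^ p) ^ (1 / p) ≤ pVar p P a b :=
    le_iSup_of_le n (le_iSup_of_le (fun i : Fin (n + 1) => u i)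
      (le_iSup_of_le ⟨fun i j hij => hu hij, h0, hn⟩ le_rfl))
  rw [one_div, ENNReal.rpow_inv_le_iff hp] at h
  have h' := ENNReal.toReal_mono (ENNReal.rpow_ne_top_of_nonneg hp.le hP.ne) h
  rw [← ENNReal.toReal_rpow, ENNReal.toReal_sum (fun i _ => by simp [hp.le]),
    Fin.sum_univ_eq_sum_range
      (fun i => ((‖P (u (i + 1)) - P (u i)‖₊ : ENNReal) ^ p).toReal)] at h'
  simpa [← ENNReal.toReal_rpow] using h'

/-- The increments of a path of finite `p`-variation are dominated by those of a monotone
function. -/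
theorem exists_monotoneOn_control {p : ℝ} (hp : 0 < p) {P : ℝ → G} {a b : ℝ}
    (hP : pVar p P a b < ⊤) :
    ∃ v : ℝ → ℝ, MonotoneOn v (Set.Icc a b) ∧
      ∀ s t, a ≤ s → s ≤ t → t ≤ b → ‖P t - P s‖ ^ p ≤ v t - v s := by
  let S : ℝ → Set ℝ := fun t => {x | ∃ (n : ℕ) (u : ℕ → ℝ), Monotone u ∧ u 0 = a ∧ u n = t ∧
    x = ∑ i ∈ Finset.range n, ‖P (u (i + 1)) - P (u i)‖ ^ p}
  have hext : ∀ s t, s ≤ t → ∀ x ∈ S s, x + ‖P t - P s‖ ^ p ∈ S t := by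
    rintro s t hst x ⟨n, u, hu, h0, hn, rfl⟩
    refine ⟨n + 1, fun i => if i ≤ n then u i else t, ?_, by simp [h0], by simp, ?_⟩
    · intro i j hij
      dsimp only
      split_ifs with h1 h2
      · exact hu hij
      · exact (hu h1).trans (hn.le.trans hst)
      · omega
      · exact le_rfl
    · rw [Finset.sum_range_succ]
      congr 1
      · refine Finset.sum_congr rfl fun i hi => ?_
        have hi : i < n := Finset.mem_range.1 hi
        simp [hi.le, Nat.succ_le_of_lt hi]
      · simp [hn]
  have hbdd : ∀ t, t ≤ b → BddAbove (S t) := by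
    intro t ht
    refine ⟨(pVar p P a b).toReal ^ p, fun x hx => ?_⟩
    obtain ⟨n, u, hu, h0, hn, hx'⟩ := hext t b ht x hx
    have h := sum_rpow_le_pVar hp hP hu h0 hn
    have h2 : 0 ≤ ‖P b - P t‖ ^ p := by positivity
    linarith
  have hne : ∀ t, a ≤ t → (S t).Nonempty := fun t ht =>
    ⟨_, hext a t ht _ ⟨0, fun _ => a, monotone_const, rfl, rfl, rfl⟩⟩
  have key : ∀ s t, a ≤ s → s ≤ t → t ≤ b → ‖P t - P s‖ ^ p ≤ sSup (S t) - sSup (S s) := by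
    intro s t has hst htb
    have h : sSup (S s) ≤ sSup (S t) - ‖P t - P s‖ ^ p :=
      csSup_le (hne s has) fun x hx => by
        linarith [le_csSup (hbdd t htb) (hext s t hst x hx)]
    linarith
  refine ⟨fun t => sSup (S t), fun s hs t ht hst => ?_, key⟩
  have h := key s t hs.1 hst ht.2
  have h2 : 0 ≤ ‖P t - P s‖ ^ p := by positivity
  dsimp only
  linarith

/-- The increments of `P` on `[a, b]` are dominated by the power `m` of the control with
primitive `φ`. -/
def IsControlled (φ : ℝ → ℝ) (m a b : ℝ) (P : ℝ → G) : Prop :=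
  ∃ C, 0 ≤ C ∧ ∀ s t, a ≤ s → s ≤ t → t ≤ b → ‖P t - P s‖ ≤ C * (φ t - φ s) ^ m

/-- The increments of `P` on `[a, b]` are locally negligible with respect to the power `κ` of the
control with primitive `φ`. -/
def IsLittleControlled (φ : ℝ → ℝ) (κ a b : ℝ) (P : ℝ → G) : Prop :=
  ∀ ε > 0, ∃ δ > 0, ∀ s t, a ≤ s → s ≤ t → t ≤ b → t - s ≤ δ →
    ‖P t - P s‖ ≤ ε * (φ t - φ s) ^ κ

variable {φ : ℝ → ℝ} {a b p C : ℝ} {P : ℝ → G}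

theorem increment_mem_unitInterval (hφ : MonotoneOn φ (Set.Icc a b)) (hφ1 : φ b - φ a ≤ 1)
    {s t : ℝ} (has : a ≤ s) (hst : s ≤ t) (htb : t ≤ b) : 0 ≤ φ t - φ s ∧ φ t - φ s ≤ 1 := by
  have h1 : φ a ≤ φ s := hφ ⟨le_rfl, has.trans (hst.trans htb)⟩ ⟨has, hst.trans htb⟩ has
  have h2 : φ s ≤ φ t := hφ ⟨has, hst.trans htb⟩ ⟨has.trans hst, htb⟩ hst
  have h3 : φ t ≤ φ b := hφ ⟨has.trans hst, htb⟩ ⟨has.trans (hst.trans htb), le_rfl⟩ htb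
  constructor <;> linarith

theorem rpow_le_mul_rpow {x w C ρ p m : ℝ} (hp : 0 < p) (hx : 0 ≤ x) (hw : 0 ≤ w) (hw1 : w ≤ 1)
    (hρ : 0 ≤ ρ) (hC : 0 ≤ C) (hm : 0 ≤ m) (hmp : m ≤ ρ / p) (h : x ^ p ≤ C * w) :
    x ^ ρ ≤ C ^ (ρ / p) * w ^ m := by
  have hρp : 0 ≤ ρ / p := div_nonneg hρ hp.le
  calc x ^ ρ = (x ^ p) ^ (ρ / p) := by rw [← Real.rpow_mul hx, mul_div_cancel₀ _ hp.ne']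
    _ ≤ (C * w) ^ (ρ / p) := Real.rpow_le_rpow (by positivity) h hρp
    _ = C ^ (ρ / p) * w ^ (ρ / p) := Real.mul_rpow hC hw
    _ ≤ C ^ (ρ / p) * w ^ m := mul_le_mul_of_nonneg_left
        (Real.rpow_le_rpow_of_exponent_ge' hw hw1 hm hmp) (by positivity)

theorem isControlled_of_rpow_le (hφ : MonotoneOn φ (Set.Icc a b)) (hφ1 : φ b - φ a ≤ 1)
    (hp : 0 < p) (hC : 0 ≤ C)
    (hP : ∀ s t, a ≤ s → s ≤ t → t ≤ b → ‖P t - P s‖ ^ p ≤ C * (φ t - φ s))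
    {m : ℝ} (hm : 0 ≤ m) (hmp : m ≤ 1 / p) : IsControlled φ m a b P := by
  refine ⟨C ^ (1 / p), by positivity, fun s t h1 h2 h3 => ?_⟩
  obtain ⟨h4, h5⟩ := increment_mem_unitInterval hφ hφ1 h1 h2 h3
  simpa using rpow_le_mul_rpow (ρ := 1) hp (norm_nonneg _) h4 h5 zero_le_one hC hm hmp
    (hP s t h1 h2 h3)

theorem isLittleControlled_of_rpow_le (hφ : MonotoneOn φ (Set.Icc a b)) (hφ1 : φ b - φ a ≤ 1)
    (hp : 0 < p) (hC : 0 ≤ C) (hPc : ContinuousOn P (Set.Icc a b))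
    (hP : ∀ s t, a ≤ s → s ≤ t → t ≤ b → ‖P t - P s‖ ^ p ≤ C * (φ t - φ s))
    {κ : ℝ} (hκ : 0 ≤ κ) (hκp : κ < 1 / p) : IsLittleControlled φ κ a b P := by
  intro ε hε
  have hρ0 : 0 ≤ p * κ := by positivity
  have hρ1 : p * κ < 1 := by rwa [lt_div_iff₀ hp, mul_comm] at hκp
  set D : ℝ := C ^ (p * κ / p) with hD
  have hD0 : 0 ≤ D := by positivity
  have hη : 0 < (ε / (D + 1)) ^ (1 - p * κ)⁻¹ := by positivity
  obtain ⟨δ, hδ, huc⟩ := Metric.uniformContinuousOn_iff_le.1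
    (isCompact_Icc.uniformContinuousOn_of_continuous hPc) _ hη
  refine ⟨δ, hδ, fun s t h1 h2 h3 h4 => ?_⟩
  obtain ⟨h5, h6⟩ := increment_mem_unitInterval hφ hφ1 h1 h2 h3
  have h7 := rpow_le_mul_rpow (m := κ) hp (norm_nonneg _) h5 h6 hρ0 hC hκ
    (by rw [mul_div_cancel_left₀ _ hp.ne']) (hP s t h1 h2 h3)
  have h8 := huc t ⟨h1.trans h2, h3⟩ s ⟨h1, h2.trans h3⟩
    (by rw [Real.dist_eq, abs_of_nonneg (by linarith)]; exact h4)
  rw [dist_eq_norm] at h8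
  have h9 : ‖P t - P s‖ ^ (1 - p * κ) ≤ ε / (D + 1) := by
    refine (Real.rpow_le_rpow (norm_nonneg _) h8 (by linarith)).trans_eq ?_
    rw [← Real.rpow_mul (by positivity), inv_mul_cancel₀ (by linarith), Real.rpow_one]
  calc ‖P t - P s‖ = ‖P t - P s‖ ^ (1 - p * κ) * ‖P t - P s‖ ^ (p * κ) := by
        rw [← Real.rpow_add_of_nonneg (norm_nonneg _) (by linarith) hρ0, sub_add_cancel,
          Real.rpow_one]
    _ ≤ ε / (D + 1) * (D * (φ t - φ s) ^ κ) := by gcongr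
    _ = ε * (D / (D + 1)) * (φ t - φ s) ^ κ := by ring
    _ ≤ ε * 1 * (φ t - φ s) ^ κ := by
        have : D / (D + 1) ≤ 1 := (div_le_one (by positivity)).2 (by linarith)
        gcongr
    _ = _ := by ring

/-- The defect of additivity of Riemann sums is locally negligible, uniformly over integrands whose
increments are uniformly dominated. -/
theorem IsLittleControlled.exists_forall_norm_defect_le {E F : Type*}
    [NormedAddCommGroup E] [NormedSpace ℝ E] [NormedAddCommGroup F] [NormedSpace ℝ F]
    {X : ℝ → E} {κ m : ℝ} (hX : IsLittleControlled φ κ a b X) (hφ : MonotoneOn φ (Set.Icc a b))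
    (hκ : 0 ≤ κ) (hm : 0 ≤ m) (hC : 0 ≤ C) {ε : ℝ} (hε : 0 < ε) :
    ∃ δ > 0, ∀ Z : ℝ → E →L[ℝ] F,
      (∀ s t, a ≤ s → s ≤ t → t ≤ b → ‖Z t - Z s‖ ≤ C * (φ t - φ s) ^ m) →
      ∀ r s u, a ≤ r → r ≤ s → s ≤ u → u ≤ b → u - r ≤ δ →
        ‖Z r (X u - X r) - Z r (X s - X r) - Z s (X u - X s)‖ ≤ ε * (φ u - φ r) ^ (m + κ) := by
  obtain ⟨δ, hδ, h⟩ := hX (ε / (C + 1)) (by positivity)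
  refine ⟨δ, hδ, fun Z hZ r s u h1 h2 h3 h4 h5 => ?_⟩
  have hr : r ∈ Set.Icc a b := ⟨h1, h2.trans (h3.trans h4)⟩
  have hs : s ∈ Set.Icc a b := ⟨h1.trans h2, h3.trans h4⟩
  have hu : u ∈ Set.Icc a b := ⟨h1.trans (h2.trans h3), h4⟩
  have e1 : φ r ≤ φ s := hφ hr hs h2
  have e2 : φ s ≤ φ u := hφ hs hu h3
  have hdec : Z r (X u - X r) - Z r (X s - X r) - Z s (X u - X s) =
      -((Z s - Z r) (X u - X s)) := by
    simp only [map_sub, sub_apply]; abel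
  have hw : 0 ≤ φ u - φ r := by linarith
  rw [hdec, norm_neg]
  calc _ ≤ ‖Z s - Z r‖ * ‖X u - X s‖ := ContinuousLinearMap.le_opNorm _ _
    _ ≤ C * (φ s - φ r) ^ m * (ε / (C + 1) * (φ u - φ s) ^ κ) := by
        have hsr : 0 ≤ φ s - φ r := by linarith
        have := hZ r s h1 h2 hs.2
        have := h s u hs.1 h3 h4 (by linarith)
        gcongr
    _ ≤ C * (φ u - φ r) ^ m * (ε / (C + 1) * (φ u - φ r) ^ κ) := by
        have hsr : 0 ≤ φ s - φ r := by linarith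
        have hus : 0 ≤ φ u - φ s := by linarith
        gcongr
    _ = ε * (C / (C + 1)) * (φ u - φ r) ^ (m + κ) := by
        rw [Real.rpow_add_of_nonneg hw hm hκ]; ring
    _ ≤ ε * 1 * (φ u - φ r) ^ (m + κ) := by
        have : C / (C + 1) ≤ 1 := (div_le_one (by positivity)).2 (by linarith)
        gcongr
    _ = _ := by ring

end Control

section Estimates

theorem norm_sub_le_of_holderSemiPath_le {G : Type*} [NormedAddCommGroup G] {α a b H : ℝ}
    {P : ℝ → G} (hH : 0 ≤ H) (hP : holderSemiPath α P a b ≤ ENNReal.ofReal H)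
    {s t : ℝ} (hs : s ∈ Set.Icc a b) (ht : t ∈ Set.Icc a b) :
    ‖P t - P s‖ ≤ H * |t - s| ^ α := by
  rcases eq_or_ne s t with rfl | hst
  · simp only [sub_self, norm_zero]; positivity
  have h : (‖P t - P s‖₊ : ENNReal) / edist s t ^ α ≤ ENNReal.ofReal H := by
    simp only [holderSemiPath, iSup_le_iff] at hP
    exact hP ⟨s, hs⟩ ⟨t, ht⟩ hst
  have hd : 0 < |t - s| := abs_pos.2 (sub_ne_zero.2 hst.symm)
  rw [edist_comm, edist_dist, Real.dist_eq, ENNReal.ofReal_rpow_of_pos hd,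
    ENNReal.div_le_iff (by simpa using by positivity) ENNReal.ofReal_ne_top,
    ← ENNReal.ofReal_mul hH] at h
  rw [← ENNReal.ofReal_le_ofReal_iff (by positivity), ofReal_norm]
  exact h

/-- A family of paths depending continuously on a parameter in Hölder norm is uniformly Hölder
over compact sets of parameters. -/
theorem exists_uniform_holder_bound {E G : Type*} [TopologicalSpace E] [NormedAddCommGroup G]
    {α a b : ℝ} {P : E → ℝ → G} (h1 : ∀ x, holderSemiPath α (P x) a b < ⊤)
    (h2 : ∀ x₀, Tendsto (fun x => holderNormPath α (fun s => P x s - P x₀ s) a b) (𝓝 x₀) (𝓝 0))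
    {K : Set E} (hK : IsCompact K) :
    ∃ H, 0 ≤ H ∧ ∀ x ∈ K, ∀ s ∈ Set.Icc a b, ∀ t ∈ Set.Icc a b,
      ‖P x t - P x s‖ ≤ H * |t - s| ^ α := by
  refine hK.induction_on (p := fun K => ∃ H, 0 ≤ H ∧ ∀ x ∈ K, ∀ s ∈ Set.Icc a b,
    ∀ t ∈ Set.Icc a b, ‖P x t - P x s‖ ≤ H * |t - s| ^ α) ⟨0, le_rfl, by simp⟩ ?_ ?_ ?_
  · rintro K₁ K₂ hsub ⟨H, hH, h⟩
    exact ⟨H, hH, fun x hx => h x (hsub hx)⟩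
  · rintro K₁ K₂ ⟨H₁, hH₁, h₁⟩ ⟨H₂, hH₂, h₂⟩
    refine ⟨max H₁ H₂, hH₁.trans (le_max_left _ _), ?_⟩
    rintro x (hx | hx) s hs t ht
    · exact (h₁ x hx s hs t ht).trans (by gcongr; exact le_max_left _ _)
    · exact (h₂ x hx s hs t ht).trans (by gcongr; exact le_max_right _ _)
  · intro x₀ _
    refine ⟨_, mem_nhdsWithin_of_mem_nhds ((h2 x₀).eventually (gt_mem_nhds zero_lt_one)),
      (holderSemiPath α (P x₀) a b).toReal + 1, by positivity, ?_⟩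
    intro x hx s hs t ht
    have hd := norm_sub_le_of_holderSemiPath_le (P := fun s => P x s - P x₀ s) zero_le_one
      (by rw [ENNReal.ofReal_one]; exact le_add_self.trans (le_of_lt hx)) hs ht
    have h0 := norm_sub_le_of_holderSemiPath_le (P := P x₀) ENNReal.toReal_nonneg
      (by rw [ENNReal.ofReal_toReal (h1 x₀).ne]) hs ht
    calc ‖P x t - P x s‖ = ‖(P x₀ t - P x₀ s) + ((P x t - P x₀ t) - (P x s - P x₀ s))‖ := by
          congr 1; abel
      _ ≤ _ := (norm_add_le _ _).trans (add_le_add h0 hd)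
      _ = _ := by ring

/-- A common control for finitely many paths of finite `p`-variation and for the time parameter. -/
theorem exists_common_control {E F G : Type*} [NormedAddCommGroup E] [NormedAddCommGroup F]
    [NormedAddCommGroup G] {p T : ℝ} (hp : 0 < p) (hT : 0 ≤ T) {U : ℝ → E} {X : ℝ → F}
    {V : ℝ → G} (hU : pVar p U 0 T < ⊤) (hX : pVar p X 0 T < ⊤) (hV : pVar p V 0 T < ⊤) :
    ∃ φ : ℝ → ℝ, MonotoneOn φ (Set.Icc 0 T) ∧ φ T - φ 0 ≤ 1 ∧ ∃ C, 0 ≤ C ∧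
      ∀ s t, 0 ≤ s → s ≤ t → t ≤ T →
        ‖U t - U s‖ ^ p ≤ C * (φ t - φ s) ∧ ‖X t - X s‖ ^ p ≤ C * (φ t - φ s) ∧
        ‖V t - V s‖ ^ p ≤ C * (φ t - φ s) ∧ t - s ≤ C * (φ t - φ s) := by
  obtain ⟨u, hum, hu⟩ := exists_monotoneOn_control hp hU
  obtain ⟨x, hxm, hx⟩ := exists_monotoneOn_control hp hX
  obtain ⟨v, hvm, hv⟩ := exists_monotoneOn_control hp hV
  let ψ : ℝ → ℝ := fun t => u t + x t + v t + t
  have hψ : MonotoneOn ψ (Set.Icc 0 T) := ((hum.add hxm).add hvm).add monotoneOn_id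
  have h0 : ψ 0 ≤ ψ T := hψ ⟨le_rfl, hT⟩ ⟨hT, le_rfl⟩ hT
  have hW : 0 < ψ T - ψ 0 + 1 := by linarith
  refine ⟨fun t => ψ t / (ψ T - ψ 0 + 1), fun s hs t ht hst =>
    div_le_div_of_nonneg_right (hψ hs ht hst) hW.le, ?_, ψ T - ψ 0 + 1, hW.le, ?_⟩
  · rw [← sub_div, div_le_one hW]; linarith
  · intro s t hs hst ht
    have e : (ψ T - ψ 0 + 1) * (ψ t / (ψ T - ψ 0 + 1) - ψ s / (ψ T - ψ 0 + 1)) = ψ t - ψ s := by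
      rw [← sub_div, mul_div_cancel₀ _ hW.ne']
    have hs' : s ∈ Set.Icc 0 T := ⟨hs, hst.trans ht⟩
    have ht' : t ∈ Set.Icc 0 T := ⟨hs.trans hst, ht⟩
    have e1 := hum hs' ht' hst
    have e2 := hxm hs' ht' hst
    have e3 := hvm hs' ht' hst
    have e4 := hu s t hs hst ht
    have e5 := hx s t hs hst ht
    have e6 := hv s t hs hst ht
    rw [e]
    simp only [ψ]
    exact ⟨by linarith, by linarith, by linarith, by linarith⟩

theorem exists_norm_le_on_compact_prod {E F : Type*} [NormedAddCommGroup E] [NormedAddCommGroup F]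
    {H : ℝ × E → F} (hH : Continuous H) {I : Set ℝ} {K : Set E}
    (hI : IsCompact I) (hK : IsCompact K) :
    ∃ B, 0 ≤ B ∧ ∀ t ∈ I, ∀ x ∈ K, ‖H (t, x)‖ ≤ B := by
  obtain ⟨B, hB⟩ := (hI.prod hK).exists_bound_of_continuousOn hH.continuousOn
  exact ⟨max B 0, le_max_right _ _, fun t ht x hx => (hB (t, x) ⟨ht, hx⟩).trans (le_max_left _ _)⟩

variable {E F G : Type*} [NormedAddCommGroup E] [NormedSpace ℝ E]
  [NormedAddCommGroup F] [NormedSpace ℝ F] [NormedAddCommGroup G] [NormedSpace ℝ G]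

theorem IsCompact.exists_convex_isCompact_superset [CompleteSpace E] {s : Set E}
    (hs : IsCompact s) : ∃ K, IsCompact K ∧ Convex ℝ K ∧ s ⊆ K :=
  ⟨closure (convexHull ℝ s),
    hs.totallyBounded.convexHull.closure.isCompact_of_isClosed isClosed_closure,
    (convex_convexHull ℝ s).closure, (subset_convexHull ℝ s).trans subset_closure⟩

theorem exists_uniform_lipschitz_bound {Φ : ℝ → E → F} (hΦ : ∀ t, Differentiable ℝ (Φ t))
    (hc : Continuous fun pr : ℝ × E => fderiv ℝ (Φ pr.1) pr.2) {I : Set ℝ} {K : Set E}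
    (hI : IsCompact I) (hK : IsCompact K) (hKc : Convex ℝ K) :
    ∃ B, 0 ≤ B ∧ ∀ t ∈ I, ∀ x ∈ K, ∀ y ∈ K, ‖Φ t y - Φ t x‖ ≤ B * ‖y - x‖ := by
  obtain ⟨B, hB0, hB⟩ := exists_norm_le_on_compact_prod hc hI hK
  exact ⟨B, hB0, fun t ht x hx y hy => hKc.norm_image_sub_le_of_norm_fderiv_le
    (fun z _ => hΦ t z) (fun z hz => hB t ht z hz) hx hy⟩

theorem exists_uniform_taylor_bound {Φ : ℝ → E → F} (hΦ : ∀ t, ContDiff ℝ 2 (Φ t))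
    (hc : Continuous fun pr : ℝ × E => fderiv ℝ (fun z => fderiv ℝ (Φ pr.1) z) pr.2)
    {I : Set ℝ} {K : Set E} (hI : IsCompact I) (hK : IsCompact K) (hKc : Convex ℝ K) :
    ∃ B, 0 ≤ B ∧ ∀ t ∈ I, ∀ x ∈ K, ∀ y ∈ K,
      ‖Φ t y - Φ t x - fderiv ℝ (Φ t) x (y - x)‖ ≤ B * ‖y - x‖ * ‖y - x‖ := by
  obtain ⟨B, hB0, hB⟩ := exists_uniform_lipschitz_bound (Φ := fun t z => fderiv ℝ (Φ t) z)
    (fun t => ((hΦ t).fderiv_right (m := 1) (by norm_num)).differentiable one_ne_zero) hc hI hK hKc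
  refine ⟨B, hB0, fun t ht x hx y hy => ?_⟩
  refine (convex_segment x y).norm_image_sub_le_of_norm_fderiv_le'
    (fun z _ => ((hΦ t).differentiable two_ne_zero) z) (fun z hz => ?_)
    (left_mem_segment ℝ x y) (right_mem_segment ℝ x y)
  refine (hB t ht x hx z (hKc.segment_subset hx hy hz)).trans ?_
  gcongr
  obtain ⟨c, hc, rfl⟩ := (segment_eq_image' ℝ x y ▸ hz :)
  rw [add_sub_cancel_left, norm_smul, Real.norm_of_nonneg hc.1]
  exact mul_le_of_le_one_left (norm_nonneg _) hc.2

end Estimates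

/-- Decomposition of flows (Kunita-type formula): if `dV = f(V)dU` and `Y` is a flow of
`dY = g(Y)dX` by twice continuously differentiable diffeomorphisms, then `Z_t = Y_t(V_t)`
satisfies `Z_t = V_0 + ∫_0^t g(Z_s) dX_s + ∫_0^t ((Y_s)_* f)(Z_s) dU_s`, where
`((Y_s)_* f)(z) = D_xY_s(Y_s^{-1}(z)) ∘ f(Y_s^{-1}(z))`, all Young integrals existing. -/
theorem kunita_decomposition_young
    {E₀ E₁ E : Type*} [NormedAddCommGroup E₀] [NormedSpace ℝ E₀] [CompleteSpace E₀]
    [NormedAddCommGroup E₁] [NormedSpace ℝ E₁] [CompleteSpace E₁]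
    [NormedAddCommGroup E] [NormedSpace ℝ E] [CompleteSpace E]
    (p q γ T : ℝ) (hp1 : 1 ≤ p) (hp2 : p < 2) (hq : 1 ≤ q) (hpq : 1 / p + 1 / q > 1)
    (hγ0 : 0 < γ) (hγ1 : γ ≤ 1) (hγp : p < 1 + γ) (hT : 0 ≤ T)
    (U : ℝ → E₀) (hU : MemVp p U 0 T)
    (X : ℝ → E₁) (hX : MemVp p X 0 T)
    (f : E → E₀ →L[ℝ] E) (hfC1 : ContDiff ℝ 1 f)
    (hf : ∃ C : ℝ, ∀ x y : E, ‖fderiv ℝ f x - fderiv ℝ f y‖ ≤ C * ‖x - y‖ ^ γ)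
    (g : E → E₁ →L[ℝ] E) (hgC1 : ContDiff ℝ 1 g)
    (hg : ∃ C : ℝ, ∀ x y : E, ‖fderiv ℝ g x - fderiv ℝ g y‖ ≤ C * ‖x - y‖ ^ γ)
    (V : ℝ → E) (hV : MemVp p V 0 T)
    (hVeq : ∀ t ∈ Set.Icc (0 : ℝ) T, IsYoungIntegral (fun s => f (V s)) U 0 t (V t - V 0))
    (Y : ℝ → E → E) (Yinv : ℝ → E → E)
    (hYp : ∀ x : E, MemVp p (fun t => Y t x) 0 T)
    (hYeq : ∀ x : E, ∀ t ∈ Set.Icc (0 : ℝ) T,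
      IsYoungIntegral (fun s => g (Y s x)) X 0 t (Y t x - x))
    (hYdiffeo : ∀ t : ℝ, ContDiff ℝ 2 (Y t) ∧ Function.LeftInverse (Yinv t) (Y t) ∧
      Function.RightInverse (Yinv t) (Y t) ∧ ContDiff ℝ 2 (Yinv t))
    (hYc : Continuous fun pr : ℝ × E => Y pr.1 pr.2)
    (hDYc : Continuous fun pr : ℝ × E => fderiv ℝ (Y pr.1) pr.2)
    (hD2Yc : Continuous fun pr : ℝ × E => fderiv ℝ (fun z => fderiv ℝ (Y pr.1) z) pr.2)
    (hgY1 : ∀ x : E, holderSemiPath (1 / q) (fun s => g (Y s x)) 0 T < ⊤)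
    (hgY2 : ∀ x₀ : E, Filter.Tendsto
      (fun x => holderNormPath (1 / q) (fun s => g (Y s x) - g (Y s x₀)) 0 T)
      (nhds x₀) (nhds 0)) :
    ∀ t ∈ Set.Icc (0 : ℝ) T, ∃ I₁ I₂ : E,
      IsYoungIntegral (fun s => g (Y s (V s))) X 0 t I₁ ∧
      IsYoungIntegral (fun s =>
        (fderiv ℝ (Y s) (Yinv s (Y s (V s)))).comp (f (Yinv s (Y s (V s))))) U 0 t I₂ ∧
      Y t (V t) = V 0 + I₁ + I₂ := by
  have hp0 : 0 < p := by linarith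
  have hq0 : 0 < q := by linarith
  -- the Hölder exponent of the integrands and a slightly weakened one for the integrators
  set m : ℝ := min (1 / p) (1 / q) with hm
  have hm0 : 0 < m := lt_min (by positivity) (by positivity)
  have hmp : m ≤ 1 / p := min_le_left _ _
  have hmq : m ≤ 1 / q := min_le_right _ _
  have hm1 : 1 / p + m > 1 := by
    rcases min_choice (1 / p) (1 / q) with h | h
    · rw [hm, h]
      have : 1 / 2 < 1 / p := one_div_lt_one_div_of_lt hp0 hp2
      linarith
    · rw [hm, h]; exact hpq
  have hp1' : 1 / p ≤ 1 := by rw [div_le_one hp0]; exact hp1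
  obtain ⟨κ, hκl, hκp⟩ := exists_between (show 1 - m < 1 / p by linarith)
  have hκ0 : 0 ≤ κ := by linarith
  have hθ : 1 < m + κ := by linarith
  obtain ⟨φ, hφ, hφ1, C, hC, hφC⟩ := exists_common_control hp0 hT hU.2 hX.2 hV.2
  have hw := fun {s t : ℝ} => increment_mem_unitInterval (s := s) (t := t) hφ hφ1
  have hUl : IsLittleControlled φ κ 0 T U := isLittleControlled_of_rpow_le hφ hφ1 hp0 hC hU.1
    (fun s t h1 h2 h3 => (hφC s t h1 h2 h3).1) hκ0 hκp
  have hXl : IsLittleControlled φ κ 0 T X := isLittleControlled_of_rpow_le hφ hφ1 hp0 hC hX.1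
    (fun s t h1 h2 h3 => (hφC s t h1 h2 h3).2.1) hκ0 hκp
  have hVl : IsLittleControlled φ κ 0 T V := isLittleControlled_of_rpow_le hφ hφ1 hp0 hC hV.1
    (fun s t h1 h2 h3 => (hφC s t h1 h2 h3).2.2.1) hκ0 hκp
  obtain ⟨CV, hCV0, hCV⟩ : IsControlled φ m 0 T V := isControlled_of_rpow_le hφ hφ1 hp0 hC
    (fun s t h1 h2 h3 => (hφC s t h1 h2 h3).2.2.1) hm0.le hmp
  obtain ⟨Ct, hCt0, hCt⟩ : ∃ Ct, 0 ≤ Ct ∧ ∀ s t, 0 ≤ s → s ≤ t → t ≤ T →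
      |t - s| ^ (1 / q) ≤ Ct * (φ t - φ s) ^ m := by
    refine ⟨C ^ (1 / q / 1), by positivity, fun s t h1 h2 h3 => ?_⟩
    have h4 := hw h1 h2 h3
    refine rpow_le_mul_rpow one_pos (abs_nonneg _) h4.1 h4.2 (by positivity) hC hm0.le
      (by rwa [div_one]) ?_
    rw [Real.rpow_one, abs_of_nonneg (by linarith)]
    exact (hφC s t h1 h2 h3).2.2.2
  -- uniform bounds on a compact convex set containing the path `V`
  obtain ⟨K, hK, hKc, hVK⟩ :=
    (isCompact_Icc.image_of_continuousOn hV.1).exists_convex_isCompact_superset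
  have hVmem : ∀ {s : ℝ}, 0 ≤ s → s ≤ T → V s ∈ K := fun h1 h2 =>
    hVK (Set.mem_image_of_mem V ⟨h1, h2⟩)
  have hYd : ∀ t, Differentiable ℝ (Y t) := fun t => (hYdiffeo t).1.differentiable two_ne_zero
  have hgd : Differentiable ℝ g := hgC1.differentiable one_ne_zero
  obtain ⟨Bf, hBf0, hBf⟩ := exists_uniform_lipschitz_bound (Φ := fun _ : ℝ => f)
    (fun _ => hfC1.differentiable one_ne_zero)
    ((hfC1.continuous_fderiv one_ne_zero).comp continuous_snd)
    (isCompact_Icc (a := 0) (b := T)) hK hKc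
  obtain ⟨Bg, hBg0, hBg⟩ := exists_uniform_lipschitz_bound (Φ := fun t x => g (Y t x))
    (fun t => hgd.comp (hYd t))
    (by
      have h : (fun pr : ℝ × E => fderiv ℝ (fun x => g (Y pr.1 x)) pr.2) =
          fun pr => (fderiv ℝ g (Y pr.1 pr.2)).comp (fderiv ℝ (Y pr.1) pr.2) :=
        funext fun pr => fderiv_comp pr.2 (hgd _) (hYd pr.1 pr.2)
      rw [h]
      exact ((hgC1.continuous_fderiv one_ne_zero).comp hYc).clm_comp hDYc)
    (isCompact_Icc (a := 0) (b := T)) hK hKc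
  obtain ⟨B1, hB10, hB1⟩ := exists_norm_le_on_compact_prod hDYc
    (isCompact_Icc (a := 0) (b := T)) hK
  obtain ⟨B2, hB20, hB2⟩ := exists_uniform_taylor_bound (fun t => (hYdiffeo t).1) hD2Yc
    (isCompact_Icc (a := 0) (b := T)) hK hKc
  obtain ⟨H, hH0, hH⟩ := exists_uniform_holder_bound (P := fun x s => g (Y s x))
    hgY1 hgY2 hK
  have hYg : ∀ x ∈ K, ∀ s t, 0 ≤ s → s ≤ t → t ≤ T →
      ‖g (Y t x) - g (Y s x)‖ ≤ H * Ct * (φ t - φ s) ^ m := by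
    intro x hx s t h1 h2 h3
    refine (hH x hx s ⟨h1, h2.trans h3⟩ t ⟨h1.trans h2, h3⟩).trans ?_
    rw [mul_assoc]
    exact mul_le_mul_of_nonneg_left (hCt s t h1 h2 h3) hH0
  have hfV : ∀ s t, 0 ≤ s → s ≤ t → t ≤ T →
      ‖f (V t) - f (V s)‖ ≤ Bf * CV * (φ t - φ s) ^ m := by
    intro s t h1 h2 h3
    refine (hBf s ⟨h1, h2.trans h3⟩ _ (hVmem h1 (h2.trans h3)) _ (hVmem (h1.trans h2) h3)).trans ?_
    rw [mul_assoc]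
    exact mul_le_mul_of_nonneg_left (hCV s t h1 h2 h3) hBf0
  have hgZ : ∀ s t, 0 ≤ s → s ≤ t → t ≤ T →
      ‖g (Y t (V t)) - g (Y s (V s))‖ ≤ (H * Ct + Bg * CV) * (φ t - φ s) ^ m := by
    intro s t h1 h2 h3
    have hs := hVmem h1 (h2.trans h3)
    have ht := hVmem (h1.trans h2) h3
    have e1 := hYg _ ht s t h1 h2 h3
    have e2 := (hBg s ⟨h1, h2.trans h3⟩ _ hs _ ht).trans
      (mul_le_mul_of_nonneg_left (hCV s t h1 h2 h3) hBg0)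
    calc _ ≤ _ := norm_sub_le_norm_sub_add_norm_sub _ (g (Y s (V t))) _
      _ ≤ _ := add_le_add e1 e2
      _ = _ := by ring
  -- local expansion of the path `t ↦ Y t (V t)`
  have hexp : ∀ ε > 0, ∃ δ > 0, ∀ r u, 0 ≤ r → r ≤ u → u ≤ T → u - r ≤ δ →
      ‖(fderiv ℝ (Y r) (V r) (f (V r) (U u - U r)) + g (Y r (V r)) (X u - X r)) -
        (Y u (V u) - Y r (V r))‖ ≤ ε * (φ u - φ r) ^ (m + κ) := by
    intro ε hε
    have hS := sewingConst_nonneg hθ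
    set D : ℝ := B2 * CV + B1 * sewingConst (m + κ) + sewingConst (m + κ) + Bg * CV with hD
    have hD0 : 0 ≤ D := by positivity
    set η : ℝ := ε / (D + 1) with hη
    have hη0 : 0 < η := by positivity
    obtain ⟨δ₁, hδ₁, h1⟩ := hVl η hη0
    obtain ⟨δ₂, hδ₂, h2⟩ := hXl η hη0
    obtain ⟨δ₃, hδ₃, h3⟩ := hUl.exists_forall_norm_defect_le (F := E) hφ hκ0 hm0.le
      (mul_nonneg hBf0 hCV0) hη0
    obtain ⟨δ₄, hδ₄, h4⟩ := hXl.exists_forall_norm_defect_le (F := E) hφ hκ0 hm0.le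
      (mul_nonneg hH0 hCt0) hη0
    refine ⟨min (min δ₁ δ₂) (min δ₃ δ₄), by positivity, fun r u hr hru hu hδ => ?_⟩
    simp only [le_min_iff] at hδ
    obtain ⟨⟨hd1, hd2⟩, hd3, hd4⟩ := hδ
    have hrK := hVmem hr (hru.trans hu)
    have huK := hVmem (hr.trans hru) hu
    have hrT : r ∈ Set.Icc 0 T := ⟨hr, hru.trans hu⟩
    have hw0 := (hw hr hru hu).1
    have k1 := h1 r u hr hru hu hd1
    have k2 := h2 r u hr hru hu hd2
    have k3 := norm_increment_sub_germ_le (A := fun s t => f (V s) (U t - U s))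
      (J := fun t => V t - V 0) hφ hθ (fun s => by simp) hVeq hη0.le
      (h3 _ hfV) hr hru hu hd3
    have k4 := norm_increment_sub_germ_le (A := fun s t => g (Y s (V u)) (X t - X s))
      (J := fun t => Y t (V u) - V u) hφ hθ (fun s => by simp) (hYeq (V u)) hη0.le
      (h4 _ (hYg _ huK)) hr hru hu hd4
    simp only [sub_sub_sub_cancel_right] at k3 k4
    have k5 := hCV r u hr hru hu
    have e1 : ‖Y r (V u) - Y r (V r) - fderiv ℝ (Y r) (V r) (V u - V r)‖ ≤
        B2 * (CV * (φ u - φ r) ^ m) * (η * (φ u - φ r) ^ κ) :=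
      (hB2 r hrT _ hrK _ huK).trans (by gcongr)
    have e2 : ‖fderiv ℝ (Y r) (V r) (V u - V r - f (V r) (U u - U r))‖ ≤
        B1 * (sewingConst (m + κ) * η * (φ u - φ r) ^ (m + κ)) :=
      (ContinuousLinearMap.le_opNorm _ _).trans (by gcongr; exact hB1 r hrT _ hrK)
    have e3 : ‖(g (Y r (V u)) - g (Y r (V r))) (X u - X r)‖ ≤
        Bg * (CV * (φ u - φ r) ^ m) * (η * (φ u - φ r) ^ κ) := by
      refine (ContinuousLinearMap.le_opNorm _ _).trans ?_
      have := (hBg r hrT _ hrK _ huK).trans (mul_le_mul_of_nonneg_left k5 hBg0)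
      gcongr
    have hdec : (fderiv ℝ (Y r) (V r) (f (V r) (U u - U r)) + g (Y r (V r)) (X u - X r)) -
        (Y u (V u) - Y r (V r)) =
        -((Y r (V u) - Y r (V r) - fderiv ℝ (Y r) (V r) (V u - V r)) +
          fderiv ℝ (Y r) (V r) (V u - V r - f (V r) (U u - U r)) +
          (Y u (V u) - Y r (V u) - g (Y r (V u)) (X u - X r)) +
          (g (Y r (V u)) - g (Y r (V r))) (X u - X r)) := by
      rw [map_sub (fderiv ℝ (Y r) (V r)) (V u - V r), sub_apply]
      abel
    rw [hdec, norm_neg]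
    calc _ ≤ _ := norm_add₄_le
      _ ≤ _ := add_le_add (add_le_add (add_le_add e1 e2) k4) e3
      _ = ε * (D / (D + 1)) * (φ u - φ r) ^ (m + κ) := by
        rw [Real.rpow_add_of_nonneg hw0 hm0.le hκ0, hη, hD]; ring
      _ ≤ ε * 1 * (φ u - φ r) ^ (m + κ) := by
        have : D / (D + 1) ≤ 1 := (div_le_one (by positivity)).2 (by linarith)
        gcongr
      _ = _ := by ring
  have hY0 : Y 0 (V 0) = V 0 := by
    by_contra hne
    obtain ⟨δ, hδ, h⟩ := YoungPartition.tendsto_comap_mesh_iff.1 (hYeq (V 0) 0 ⟨le_rfl, hT⟩)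
      ‖Y 0 (V 0) - V 0‖ (norm_pos_iff.2 (sub_ne_zero.2 hne))
    have h' := h (.ofSeq (fun _ => 0) monotone_const 0 rfl rfl)
      (lt_of_le_of_lt (YoungPartition.mesh_ofSeq_le le_rfl (by simp)) hδ)
    simp [riemannSum, YoungPartition.ofSeq, norm_sub_rev] at h'
  intro t ht
  have hφt : MonotoneOn φ (Set.Icc 0 t) := hφ.mono (Set.Icc_subset_Icc le_rfl ht.2)
  have hφt1 : φ t - φ 0 ≤ 1 := (hw le_rfl ht.1 ht.2).2
  obtain ⟨I₁, hI₁⟩ := IsAlmostAdditive.exists_tendsto_germSum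
    (A := fun r u => g (Y r (V r)) (X u - X r)) (θ := m + κ) (a := 0) (b := t)
    (fun ε hε => by
      obtain ⟨δ, hδ, h⟩ := hXl.exists_forall_norm_defect_le (F := E) hφ hκ0 hm0.le
        (by positivity : 0 ≤ H * Ct + Bg * CV) hε
      exact ⟨δ, hδ, fun r s u h1 h2 h3 h4 h5 => h _ hgZ r s u h1 h2 h3 (h4.trans ht.2) h5⟩)
    hφt hφt1 hθ (fun s => by simp)
  have hsum := tendsto_germSum_of_increment (J := fun s => Y s (V s)) hφt hφt1 hθ fun ε hε => by
    obtain ⟨δ, hδ, h⟩ := hexp ε hε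
    exact ⟨δ, hδ, fun r u h1 h2 h3 h4 => h r u h1 h2 (h3.trans ht.2) h4⟩
  refine ⟨I₁, Y t (V t) - Y 0 (V 0) - I₁, hI₁, ?_, by rw [hY0]; abel⟩
  refine (hsum.sub hI₁).congr fun D => ?_
  simp only [germSum, riemannSum, ← Finset.sum_sub_distrib, add_sub_cancel_right,
    (hYdiffeo _).2.1 _, ContinuousLinearMap.comp_apply]
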